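/- Let α ∈ (0,1), a < b reals, A a real symmetric d×d matrix, B a real d×N matrix, and g : [a,b] → ℝ continuous with g(t) ≠ 0 for almost every t ∈ [a,b]. Define scalar kernels h₀(t) = (b−t)^{α−1}/Γ(α) and h_{k+1}(t) = (1/Γ(α)) ∫_t^b (s−t)^{α−1} g(s) h_k(s) ds for t ∈ [a,b), and assume that for each t ∈ [a,b) the series Φ(t) = Σ_{k=0}^∞ A^k h_k(t) of d×d matrices converges absolutely, and that t ↦ (b−t)^{1−α} Φ(t) extends to a continuous function on [a,b]. Define the controllability Gramian W = ∫_a^b (b−t)^{1−α} Φ(t) B Bᵀ Φ(t)ᵀ dt. Then W is invertible if and only if the columns of the matrices A^k B for k = 0,1,…,d−1 together span ℝ^d (Kalman rank condition). -/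

import Mathlib

open MeasureTheory Set Matrix

attribute [local instance] Matrix.normedAddCommGroup Matrix.normedSpace

/-- The scaled Euler beta integral over `[t, b]`. -/
theorem integral_sub_rpow_mul_sub_rpow {p q t b : ℝ} (hp : 0 < p) (hq : 0 < q) (htb : t < b) :
    ∫ s in t..b, (s - t) ^ (p - 1) * (b - s) ^ (q - 1) =
      ProbabilityTheory.beta p q * (b - t) ^ (p + q - 1) := by
  have hT : 0 < b - t := sub_pos.2 htb
  have h1 : ∫ s in t..b, (s - t) ^ (p - 1) * (b - s) ^ (q - 1) =
      ∫ x in (0:ℝ)..(b - t), x ^ (p - 1) * ((b - t) - x) ^ (q - 1) := by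
    have := intervalIntegral.integral_comp_sub_right (a := t) (b := b)
      (fun x : ℝ => x ^ (p - 1) * ((b - t) - x) ^ (q - 1)) t
    simpa using this
  have h2 := Complex.betaIntegral_scaled (p : ℂ) (q : ℂ) hT
  rw [h1]
  apply Complex.ofReal_injective
  rw [← intervalIntegral.integral_ofReal]
  have h3 : ∫ x in (0:ℝ)..(b - t), ((x ^ (p - 1) * ((b - t) - x) ^ (q - 1) : ℝ) : ℂ) =
      ∫ x in (0:ℝ)..(b - t), (x : ℂ) ^ ((p : ℂ) - 1) * (((b - t : ℝ) : ℂ) - x) ^ ((q : ℂ) - 1) := by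
    refine intervalIntegral.integral_congr fun x hx => ?_
    rw [uIcc_of_le hT.le] at hx
    rw [Complex.ofReal_mul, Complex.ofReal_cpow hx.1, Complex.ofReal_cpow (sub_nonneg.2 hx.2)]
    push_cast
    rfl
  rw [h3, h2, Complex.betaIntegral_eq_Gamma_mul_div _ _ (by simpa) (by simpa),
    ProbabilityTheory.beta, Complex.ofReal_mul, Complex.ofReal_cpow hT.le]
  push_cast [← Complex.Gamma_ofReal]
  ring

theorem intervalIntegrable_sub_rpow_mul_sub_rpow {p q t b : ℝ} (hp : 0 < p) (hq : 0 < q)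
    (htb : t < b) :
    IntervalIntegrable (fun s => (s - t) ^ (p - 1) * (b - s) ^ (q - 1)) volume t b := by
  apply intervalIntegral.intervalIntegrable_of_integral_ne_zero
  rw [integral_sub_rpow_mul_sub_rpow hp hq htb]
  exact (mul_pos (ProbabilityTheory.beta_pos hp hq) (Real.rpow_pos_of_pos (sub_pos.2 htb) _)).ne'

theorem intervalIntegrable_sub_rpow {α : ℝ} (hα : 0 < α) (a b : ℝ) :
    IntervalIntegrable (fun s : ℝ => (b - s) ^ (α - 1)) volume a b := by
  have := (intervalIntegral.intervalIntegrable_rpow' (a := b - a) (b := 0) (r := α - 1)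
    (by linarith)).comp_sub_left b
  simpa using this

theorem continuousOn_sub_rpow (p a b : ℝ) :
    ContinuousOn (fun t : ℝ => (b - t) ^ p) (Ico a b) := fun _ ht =>
  ((continuousAt_const.sub continuousAt_id).rpow_const
    (Or.inl (sub_pos.2 ht.2).ne')).continuousWithinAt

theorem exp_neg_mul_rpow_le_Gamma {R y : ℝ} (hR : 0 < R) (hy : 1 ≤ y) :
    Real.exp (-(R + 1)) * R ^ (y - 1) ≤ Real.Gamma y := by
  have hy0 : 0 < y := by linarith
  rw [Real.Gamma_eq_integral hy0]
  have hint := Real.GammaIntegral_convergent hy0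
  calc Real.exp (-(R + 1)) * R ^ (y - 1)
      = ∫ _ in Ioc R (R + 1), Real.exp (-(R + 1)) * R ^ (y - 1) := by simp
    _ ≤ ∫ x in Ioc R (R + 1), Real.exp (-x) * x ^ (y - 1) := by
        refine setIntegral_mono_on (integrableOn_const (by simp)) (hint.mono_set fun x hx => hR.trans hx.1)
          measurableSet_Ioc fun x hx => ?_
        exact mul_le_mul (Real.exp_le_exp.2 (neg_le_neg hx.2))
          (Real.rpow_le_rpow hR.le hx.1.le (by linarith)) (by positivity) (by positivity)
    _ ≤ ∫ x in Ioi 0, Real.exp (-x) * x ^ (y - 1) := by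
        refine setIntegral_mono_set hint ?_ (LE.le.eventuallyLE fun x hx => hR.trans hx.1)
        filter_upwards [ae_restrict_mem measurableSet_Ioi] with x hx
        have : (0 : ℝ) < x := hx
        simp only [Pi.zero_apply]
        positivity

/-- The Mittag-Leffler coefficients `1 / Γ((k + 1) α)` decay faster than any geometric sequence. -/
theorem summable_pow_div_Gamma {α : ℝ} (hα : 0 < α) {r : ℝ} (hr : 0 ≤ r) :
    Summable fun k : ℕ => r ^ k / Real.Gamma ((k + 1) * α) := by
  set R : ℝ := (2 * r + 1) ^ (1 / α) with hR
  have hR0 : 0 < R := by positivity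
  have hRα : R ^ α = 2 * r + 1 := by
    rw [hR, ← Real.rpow_mul (by positivity), one_div_mul_cancel hα.ne', Real.rpow_one]
  have hgeo : Summable fun k : ℕ =>
      (Real.exp (R + 1) * R ^ (1 - α)) * (r / (2 * r + 1)) ^ k := by
    refine (summable_geometric_of_lt_one (by positivity) ?_).mul_left _
    rw [div_lt_one (by positivity)]; linarith
  refine hgeo.of_norm_bounded_eventually_nat ?_
  obtain ⟨n, hn⟩ := exists_nat_ge (1 / α)
  filter_upwards [Filter.eventually_ge_atTop n] with k hk
  have hk1 : 1 ≤ (k + 1) * α := by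
    have : 1 / α ≤ (k + 1 : ℝ) := hn.trans (by exact_mod_cast hk.trans (Nat.le_succ k))
    rwa [div_le_iff₀ hα] at this
  have hG := exp_neg_mul_rpow_le_Gamma hR0 hk1
  have hRk : R ^ ((k + 1) * α - 1) = (2 * r + 1) ^ k * R ^ (α - 1) := by
    rw [← hRα, ← Real.rpow_natCast, ← Real.rpow_mul hR0.le, ← Real.rpow_add hR0]
    congr 1; ring
  have hGpos : 0 < Real.Gamma ((k + 1) * α) := Real.Gamma_pos_of_pos (by positivity)
  rw [Real.norm_of_nonneg (by positivity), div_le_iff₀ hGpos]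
  calc r ^ k = (Real.exp (R + 1) * R ^ (1 - α)) * (r / (2 * r + 1)) ^ k *
        (Real.exp (-(R + 1)) * R ^ ((k + 1) * α - 1)) := by
        rw [hRk, Real.exp_neg, div_pow, show 1 - α = -(α - 1) by ring, Real.rpow_neg hR0.le]
        field_simp
    _ ≤ _ := by gcongr

/-- The right Riemann–Liouville fractional integral is injective on continuous functions
with an admissible singularity at the endpoint. -/
theorem eq_zero_of_fractional_integral_eq_zero {α a b : ℝ} (hα : α ∈ Ioo (0:ℝ) 1) {f : ℝ → ℝ}
    (hf : ContinuousOn f (Ico a b)) (hfi : IntervalIntegrable f volume a b)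
    (hzero : ∀ t ∈ Ico a b, ∫ s in t..b, (s - t) ^ (α - 1) * f s = 0) :
    ∀ t ∈ Ioo a b, f t = 0 := by
  obtain ⟨hα0, hα1⟩ := hα
  have key : ∀ u ∈ Ico a b, ∫ s in u..b, f s = 0 := by
    intro u hu
    have hfu : IntegrableOn f (Ioo u b) := by
      have := (intervalIntegrable_iff_integrableOn_Ioo_of_le (hu.1.trans hu.2.le)).1 hfi
      exact this.mono_set (Ioo_subset_Ioo_left hu.1)
    set c : ℝ := ProbabilityTheory.beta (1 - α) α with hc
    have hc0 : 0 < c := ProbabilityTheory.beta_pos (by linarith) hα0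
    set w : ℝ → ℝ → ℝ := fun t s => (t - u) ^ (1 - α - 1) * (s - t) ^ (α - 1) with hw
    set K : ℝ × ℝ → ℝ := {p : ℝ × ℝ | p.1 < p.2}.indicator (fun p => w p.1 p.2 * f p.2) with hK
    have hlt : MeasurableSet {p : ℝ × ℝ | p.1 < p.2} := measurableSet_lt measurable_fst measurable_snd
    set μ := volume.restrict (Ioo u b) with hμ
    have hbeta : ∀ s ∈ Ioo u b, ∫ t in Ioo u s, w t s = c := by
      intro s hs
      have := integral_sub_rpow_mul_sub_rpow (p := 1 - α) (q := α) (by linarith) hα0 hs.1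
      rw [intervalIntegral.integral_of_le hs.1.le, integral_Ioc_eq_integral_Ioo] at this
      rw [this, hc]; simp
    have hbetai : ∀ s ∈ Ioo u b, IntegrableOn (fun t => w t s) (Ioo u s) := by
      intro s hs
      exact (intervalIntegrable_iff_integrableOn_Ioo_of_le hs.1.le).1
        (intervalIntegrable_sub_rpow_mul_sub_rpow (p := 1 - α) (q := α) (by linarith) hα0 hs.1)
    have hKs : ∀ s, (fun t => K (t, s)) = (Iio s).indicator (fun t => w t s * f s) := by
      intro s; ext t; simp [hK, indicator]
    have hμs : ∀ s ∈ Ioo u b, μ.restrict (Iio s) = volume.restrict (Ioo u s) := by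
      intro s hs
      rw [hμ, Measure.restrict_restrict measurableSet_Iio]
      congr 1; ext t; simp only [mem_inter_iff, mem_Iio, mem_Ioo]
      constructor
      · rintro ⟨h1, h2, h3⟩; exact ⟨h2, h1⟩
      · rintro ⟨h1, h2⟩; exact ⟨h2, h1, h2.trans hs.2⟩
    have hint_s : ∀ s ∈ Ioo u b, ∫ t, K (t, s) ∂μ = c * f s := by
      intro s hs
      rw [hKs, integral_indicator measurableSet_Iio, hμs s hs, integral_mul_const, hbeta s hs]
    have hnorm_s : ∀ s ∈ Ioo u b, ∫ t, ‖K (t, s)‖ ∂μ = c * ‖f s‖ := by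
      intro s hs
      have : (fun t => ‖K (t, s)‖) = (Iio s).indicator (fun t => ‖w t s * f s‖) := by
        ext t; rw [show K (t, s) = (fun t => K (t, s)) t from rfl, hKs, norm_indicator_eq_indicator_norm]
      rw [this, integral_indicator measurableSet_Iio, hμs s hs, ← hbeta s hs, ← integral_mul_const]
      refine setIntegral_congr_fun measurableSet_Ioo fun t ht => ?_
      have h1 : 0 < t - u := sub_pos.2 ht.1
      have h2 : 0 < s - t := sub_pos.2 ht.2
      simp only [norm_mul]
      rw [Real.norm_of_nonneg (show 0 ≤ w t s by simp only [hw]; positivity)]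
    have hKi : Integrable K (μ.prod μ) := by
      rw [integrable_prod_iff']
      · constructor
        · filter_upwards [ae_restrict_mem measurableSet_Ioo] with s hs
          rw [hKs, integrable_indicator_iff measurableSet_Iio, IntegrableOn, hμs s hs]
          exact (hbetai s hs).mul_const _
        · refine (hfu.norm.const_mul c).congr ?_
          filter_upwards [ae_restrict_mem measurableSet_Ioo] with s hs
          exact (hnorm_s s hs).symm
      · refine AEStronglyMeasurable.indicator ?_ hlt
        refine AEStronglyMeasurable.mul ?_ hfu.aestronglyMeasurable.comp_snd
        exact Measurable.aestronglyMeasurable (by simp only [hw]; fun_prop)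
    have hswap := integral_integral_swap (f := fun t s => K (t, s)) hKi
    have hleft : ∫ t, ∫ s, K (t, s) ∂μ ∂μ = 0 := by
      rw [integral_eq_zero_of_ae]
      filter_upwards [ae_restrict_mem measurableSet_Ioo] with t ht
      have h1 : (fun s => K (t, s)) =
          (Ioi t).indicator (fun s => (t - u) ^ (1 - α - 1) * ((s - t) ^ (α - 1) * f s)) := by
        ext s; simp [hK, hw, indicator, mul_assoc]
      have h2 : μ.restrict (Ioi t) = volume.restrict (Ioo t b) := by
        rw [hμ, Measure.restrict_restrict measurableSet_Ioi]
        congr 1; ext s; simp only [mem_inter_iff, mem_Ioi, mem_Ioo]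
        constructor
        · rintro ⟨h1, h2, h3⟩; exact ⟨h1, h3⟩
        · rintro ⟨h1, h2⟩; exact ⟨h1, ht.1.trans h1, h2⟩
      have h3 := hzero t ⟨hu.1.trans ht.1.le, ht.2⟩
      rw [intervalIntegral.integral_of_le ht.2.le, integral_Ioc_eq_integral_Ioo] at h3
      rw [h1, integral_indicator measurableSet_Ioi, h2, integral_const_mul, h3]
      simp
    have hright : ∫ s, ∫ t, K (t, s) ∂μ ∂μ = c * ∫ s in Ioo u b, f s := by
      rw [← integral_const_mul]
      exact setIntegral_congr_fun measurableSet_Ioo fun s hs => hint_s s hs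
    rw [intervalIntegral.integral_of_le hu.2.le, integral_Ioc_eq_integral_Ioo]
    have := hright.symm.trans (hswap.symm.trans hleft)
    exact (mul_eq_zero.1 this).resolve_left hc0.ne'
  intro t ht
  have hcont : ContinuousAt f t := hf.continuousAt (Ico_mem_nhds ht.1 ht.2)
  have hti : IntervalIntegrable f volume t b :=
    hfi.mono_set (by rw [uIcc_of_le ht.2.le, uIcc_of_le (ht.1.trans ht.2).le]
                     exact Icc_subset_Icc_left ht.1.le)
  have hd := intervalIntegral.integral_hasDerivAt_left hti
    (ContinuousOn.stronglyMeasurableAtFilter isOpen_Ioo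
      (hf.mono Ioo_subset_Ico_self) t ht) hcont
  have hd0 : HasDerivAt (fun u => ∫ s in u..b, f s) 0 t := by
    refine (hasDerivAt_const t (0:ℝ)).congr_of_eventuallyEq ?_
    filter_upwards [Ioo_mem_nhds ht.1 ht.2] with u hu
    exact key u ⟨hu.1.le, hu.2⟩
  exact neg_eq_zero.1 (hd.unique hd0)

section PeanoBaker

variable {α a b : ℝ} {g : ℝ → ℝ} {h : ℕ → ℝ → ℝ}

theorem abs_peanoBaker_kernel_le (hα : 0 < α) {M : ℝ} (hM : ∀ s ∈ Icc a b, |g s| ≤ M)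
    (h0 : ∀ t ∈ Ico a b, h 0 t = (b - t) ^ (α - 1) / Real.Gamma α)
    (hrec : ∀ k : ℕ, ∀ t ∈ Ico a b,
      h (k + 1) t = (1 / Real.Gamma α) * ∫ s in t..b, (s - t) ^ (α - 1) * g s * h k s) (k : ℕ) :
    ∀ t ∈ Ico a b, |h k t| ≤ M ^ k / Real.Gamma ((k + 1) * α) * (b - t) ^ ((k + 1) * α - 1) := by
  have hΓ : 0 < Real.Gamma α := Real.Gamma_pos_of_pos hα
  induction k with
  | zero =>
    intro t ht
    have : 0 < b - t := sub_pos.2 ht.2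
    rw [h0 t ht, abs_of_nonneg (by positivity)]
    simp [div_eq_inv_mul]
  | succ k ih =>
    intro t ht
    have hM0 : 0 ≤ M := (abs_nonneg _).trans (hM t ⟨ht.1, ht.2.le⟩)
    have hk : 0 < ((k : ℝ) + 1) * α := by positivity
    have hΓk : 0 < Real.Gamma ((k + 1) * α) := Real.Gamma_pos_of_pos hk
    have hbound : ‖∫ s in t..b, (s - t) ^ (α - 1) * g s * h k s‖ ≤
        ∫ s in t..b, M ^ (k + 1) / Real.Gamma ((k + 1) * α) *
          ((s - t) ^ (α - 1) * (b - s) ^ ((k + 1) * α - 1)) := by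
      refine intervalIntegral.norm_integral_le_of_norm_le ht.2.le ?_
        ((intervalIntegrable_sub_rpow_mul_sub_rpow hα hk ht.2).const_mul _)
      filter_upwards [Measure.ae_ne volume b] with s hsb hs
      have hs' : s < b := lt_of_le_of_ne hs.2 hsb
      have hst : 0 < s - t := sub_pos.2 hs.1
      have hbs : 0 < b - s := sub_pos.2 hs'
      have has : a ≤ s := ht.1.trans hs.1.le
      rw [norm_mul, norm_mul, Real.norm_of_nonneg (Real.rpow_nonneg hst.le _)]
      calc (s - t) ^ (α - 1) * ‖g s‖ * ‖h k s‖
          ≤ (s - t) ^ (α - 1) * M *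
            (M ^ k / Real.Gamma ((k + 1) * α) * (b - s) ^ ((k + 1) * α - 1)) := by
            gcongr
            · exact hM s ⟨has, hs'.le⟩
            · exact ih s ⟨has, hs'⟩
        _ = _ := by ring
    rw [intervalIntegral.integral_const_mul, integral_sub_rpow_mul_sub_rpow hα hk ht.2,
      ProbabilityTheory.beta, Real.norm_eq_abs] at hbound
    rw [hrec k t ht, abs_mul, abs_of_pos (by positivity)]
    refine (mul_le_mul_of_nonneg_left hbound (by positivity)).trans_eq ?_
    have e : α + ((k : ℝ) + 1) * α = (((k + 1 : ℕ) : ℝ) + 1) * α := by push_cast; ring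
    rw [e]
    have : 0 < Real.Gamma ((((k + 1 : ℕ) : ℝ) + 1) * α) := Real.Gamma_pos_of_pos (by positivity)
    field_simp

theorem abs_peanoBaker_kernel_le_geometric (hα : 0 < α) {M : ℝ} (hM : ∀ s ∈ Icc a b, |g s| ≤ M)
    (h0 : ∀ t ∈ Ico a b, h 0 t = (b - t) ^ (α - 1) / Real.Gamma α)
    (hrec : ∀ k : ℕ, ∀ t ∈ Ico a b,
      h (k + 1) t = (1 / Real.Gamma α) * ∫ s in t..b, (s - t) ^ (α - 1) * g s * h k s) (k : ℕ)
    {t : ℝ} (ht : t ∈ Ico a b) :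
    |h k t| ≤ (M * (b - a) ^ α) ^ k / Real.Gamma ((k + 1) * α) * (b - t) ^ (α - 1) := by
  refine (abs_peanoBaker_kernel_le hα hM h0 hrec k t ht).trans ?_
  have hM0 : 0 ≤ M := (abs_nonneg _).trans (hM t ⟨ht.1, ht.2.le⟩)
  have hΓk : 0 < Real.Gamma ((k + 1) * α) := Real.Gamma_pos_of_pos (by positivity)
  have hbt : 0 < b - t := sub_pos.2 ht.2
  have e : (b - t) ^ ((k + 1) * α - 1) = ((b - t) ^ α) ^ k * (b - t) ^ (α - 1) := by
    rw [← Real.rpow_natCast, ← Real.rpow_mul hbt.le, ← Real.rpow_add hbt]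
    congr 1; ring
  rw [e, mul_pow]
  have hle : ((b - t) ^ α) ^ k ≤ ((b - a) ^ α) ^ k := by
    gcongr
    exact ht.1
  calc M ^ k / Real.Gamma ((k + 1) * α) * (((b - t) ^ α) ^ k * (b - t) ^ (α - 1))
      ≤ M ^ k / Real.Gamma ((k + 1) * α) * (((b - a) ^ α) ^ k * (b - t) ^ (α - 1)) := by gcongr
    _ = _ := by ring

theorem measurable_indicator_of_continuousOn {f : ℝ → ℝ} {s : Set ℝ} (hs : MeasurableSet s)
    (hf : ContinuousOn f s) : Measurable (s.indicator f) := by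
  classical
  rw [← piecewise_eq_indicator]
  exact hf.measurable_piecewise continuousOn_const hs

theorem measurable_peanoBaker_kernel (hg : ContinuousOn g (Icc a b))
    (h0 : ∀ t ∈ Ico a b, h 0 t = (b - t) ^ (α - 1) / Real.Gamma α)
    (hrec : ∀ k : ℕ, ∀ t ∈ Ico a b,
      h (k + 1) t = (1 / Real.Gamma α) * ∫ s in t..b, (s - t) ^ (α - 1) * g s * h k s) (k : ℕ) :
    Measurable ((Ico a b).indicator (h k)) := by
  induction k with
  | zero =>
    rw [indicator_congr h0]
    exact Measurable.indicator (by fun_prop) measurableSet_Ico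
  | succ k ih =>
    have hgm := measurable_indicator_of_continuousOn measurableSet_Icc hg
    set K : ℝ × ℝ → ℝ := {p : ℝ × ℝ | p.1 < p.2}.indicator fun p =>
      (p.2 - p.1) ^ (α - 1) * (Icc a b).indicator g p.2 * (Ico a b).indicator (h k) p.2 with hK
    have hKm : Measurable K :=
      Measurable.indicator (by fun_prop) (measurableSet_lt measurable_fst measurable_snd)
    have hcongr : ∀ t ∈ Ico a b, h (k + 1) t = (1 / Real.Gamma α) * ∫ s, K (t, s) := by
      intro t ht
      rw [hrec k t ht, intervalIntegral.integral_of_le ht.2.le, integral_Ioc_eq_integral_Ioo,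
        ← integral_indicator measurableSet_Ioo]
      congr 2
      ext s
      by_cases hts : t < s
      · by_cases hsb : s < b
        · have has : a ≤ s := ht.1.trans hts.le
          simp [hK, hts, hsb, hsb.le, has]
        · simp [hK, hsb, indicator]
      · simp [hK, hts]
    rw [indicator_congr hcongr]
    have : Measurable fun t => ∫ s, K (t, s) :=
      hKm.stronglyMeasurable.integral_prod_right'.measurable
    exact Measurable.indicator (this.const_mul _) measurableSet_Ico

/-- The Volterra equation relating a scalar generalized Peano–Baker series to its shift. -/
theorem peanoBaker_series_eq (hα : 0 < α) (hg : ContinuousOn g (Icc a b))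
    (h0 : ∀ t ∈ Ico a b, h 0 t = (b - t) ^ (α - 1) / Real.Gamma α)
    (hrec : ∀ k : ℕ, ∀ t ∈ Ico a b,
      h (k + 1) t = (1 / Real.Gamma α) * ∫ s in t..b, (s - t) ^ (α - 1) * g s * h k s)
    {c : ℕ → ℝ} {C ρ : ℝ} (hρ : 0 ≤ ρ) (hc : ∀ k, |c k| ≤ C * ρ ^ k) {F G : ℝ → ℝ}
    (hF : ∀ t ∈ Ico a b, HasSum (fun k => h k t * c k) (F t))
    (hG : ∀ t ∈ Ico a b, HasSum (fun k => h k t * c (k + 1)) (G t)) :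
    ∀ t ∈ Ico a b, F t = h 0 t * c 0 +
      (1 / Real.Gamma α) * ∫ s in t..b, (s - t) ^ (α - 1) * (g s * G s) := by
  intro t ht
  obtain ⟨M, hM⟩ := isCompact_Icc.exists_bound_of_continuousOn hg
  simp only [Real.norm_eq_abs] at hM
  have hM0 : 0 ≤ M := (abs_nonneg _).trans (hM t ⟨ht.1, ht.2.le⟩)
  have hab : 0 < b - a := sub_pos.2 (ht.1.trans_lt ht.2)
  have hC0 : 0 ≤ C := by simpa using (abs_nonneg _).trans (hc 0)
  set e : ℕ → ℝ := fun k =>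
    (M * C * ρ) * ((M * (b - a) ^ α * ρ) ^ k / Real.Gamma ((k + 1) * α)) with he
  have hes : Summable e := (summable_pow_div_Gamma hα (by positivity)).mul_left _
  have hint := intervalIntegrable_sub_rpow_mul_sub_rpow hα hα ht.2
  have hsum : HasSum (fun k => ∫ s in t..b, (s - t) ^ (α - 1) * g s * h k s * c (k + 1))
      (∫ s in t..b, (s - t) ^ (α - 1) * (g s * G s)) := by
    refine intervalIntegral.hasSum_integral_of_dominated_convergence
      (fun k s => (s - t) ^ (α - 1) * (b - s) ^ (α - 1) * e k) ?_ ?_ ?_ ?_ ?_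
    · intro k
      have hm : Measurable fun s => (s - t) ^ (α - 1) * (Icc a b).indicator g s *
          (Ico a b).indicator (h k) s * c (k + 1) := by
        have h1 := measurable_indicator_of_continuousOn measurableSet_Icc hg
        have h2 := measurable_peanoBaker_kernel hg h0 hrec k
        fun_prop
      refine hm.aestronglyMeasurable.congr ?_
      filter_upwards [ae_restrict_mem measurableSet_uIoc,
        ae_restrict_of_ae (Measure.ae_ne volume b)] with s hs hsb
      rw [uIoc_of_le ht.2.le] at hs
      have has : a ≤ s := ht.1.trans hs.1.le
      simp [has, hs.2, lt_of_le_of_ne hs.2 hsb]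
    · intro k
      filter_upwards [Measure.ae_ne volume b] with s hsb hs
      rw [uIoc_of_le ht.2.le] at hs
      have hs' : s < b := lt_of_le_of_ne hs.2 hsb
      have hst : 0 < s - t := sub_pos.2 hs.1
      have has : a ≤ s := ht.1.trans hs.1.le
      have hbs : 0 < b - s := sub_pos.2 hs'
      have hΓk : 0 < Real.Gamma ((k + 1) * α) := Real.Gamma_pos_of_pos (by positivity)
      rw [norm_mul, norm_mul, norm_mul, Real.norm_of_nonneg (Real.rpow_nonneg hst.le _)]
      calc (s - t) ^ (α - 1) * ‖g s‖ * ‖h k s‖ * ‖c (k + 1)‖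
          ≤ (s - t) ^ (α - 1) * M *
            ((M * (b - a) ^ α) ^ k / Real.Gamma ((k + 1) * α) * (b - s) ^ (α - 1)) *
            (C * ρ ^ (k + 1)) := by
            gcongr
            · exact hM s ⟨has, hs'.le⟩
            · exact abs_peanoBaker_kernel_le_geometric hα hM h0 hrec k ⟨has, hs'⟩
            · exact hc (k + 1)
        _ = _ := by simp only [he]; rw [mul_pow (M * (b - a) ^ α) ρ k]; ring
    · exact Filter.Eventually.of_forall fun s _ => hes.mul_left _
    · simp only [tsum_mul_left]
      exact hint.mul_const _
    · filter_upwards [Measure.ae_ne volume b] with s hsb hs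
      rw [uIoc_of_le ht.2.le] at hs
      have := (hG s ⟨ht.1.trans hs.1.le, lt_of_le_of_ne hs.2 hsb⟩).mul_left ((s - t) ^ (α - 1) * g s)
      simpa only [mul_assoc] using this
  have hshift : HasSum (fun k => h (k + 1) t * c (k + 1))
      ((1 / Real.Gamma α) * ∫ s in t..b, (s - t) ^ (α - 1) * (g s * G s)) := by
    refine (hsum.mul_left (1 / Real.Gamma α)).congr_fun ?_
    intro k
    rw [hrec k t ht, intervalIntegral.integral_mul_const, mul_assoc]
  have h1 := (hasSum_nat_add_iff' 1).2 (hF t ht)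
  have := h1.unique hshift
  simp only [Finset.range_one, Finset.sum_singleton] at this
  linarith

theorem peanoBaker_series_eq_zero_step (hα : α ∈ Ioo (0:ℝ) 1) (hab : a < b)
    (hg : ContinuousOn g (Icc a b)) (hg0 : ∀ᵐ t ∂(volume.restrict (Icc a b)), g t ≠ 0)
    {c : ℝ} {G Ge : ℝ → ℝ} (hGe : ContinuousOn Ge (Icc a b))
    (hG : ∀ t ∈ Ico a b, G t = (b - t) ^ (α - 1) * Ge t)
    (hzero : ∀ t ∈ Ico a b, (b - t) ^ (α - 1) / Real.Gamma α * c +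
      (1 / Real.Gamma α) * ∫ s in t..b, (s - t) ^ (α - 1) * (g s * G s) = 0) :
    c = 0 ∧ ∀ t ∈ Ico a b, G t = 0 := by
  have hΓ : 0 < Real.Gamma α := Real.Gamma_pos_of_pos hα.1
  have hzero' : ∀ t ∈ Ico a b, (b - t) ^ (α - 1) * c =
      -∫ s in t..b, (s - t) ^ (α - 1) * (g s * G s) := by
    intro t ht
    have : (1 / Real.Gamma α) * ((b - t) ^ (α - 1) * c +
        ∫ s in t..b, (s - t) ^ (α - 1) * (g s * G s)) = 0 := by
      rw [← hzero t ht]; ring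
    exact eq_neg_of_add_eq_zero_left
      ((mul_eq_zero.1 this).resolve_left (one_div_pos.2 hΓ).ne')
  obtain ⟨D, hD⟩ := isCompact_Icc.exists_bound_of_continuousOn (hg.mul hGe)
  have hle : ∀ t ∈ Ico a b, |c| ≤ D * ProbabilityTheory.beta α α * (b - t) ^ α := by
    intro t ht
    have hbt : 0 < b - t := sub_pos.2 ht.2
    have hbound : ‖∫ s in t..b, (s - t) ^ (α - 1) * (g s * G s)‖ ≤
        ∫ s in t..b, D * ((s - t) ^ (α - 1) * (b - s) ^ (α - 1)) := by
      refine intervalIntegral.norm_integral_le_of_norm_le ht.2.le ?_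
        ((intervalIntegrable_sub_rpow_mul_sub_rpow hα.1 hα.1 ht.2).const_mul _)
      filter_upwards [Measure.ae_ne volume b] with s hsb hs
      have hs' : s < b := lt_of_le_of_ne hs.2 hsb
      have hst : 0 < s - t := sub_pos.2 hs.1
      have has : a ≤ s := ht.1.trans hs.1.le
      have hbs : 0 < b - s := sub_pos.2 hs'
      rw [hG s ⟨has, hs'⟩, show (s - t) ^ (α - 1) * (g s * ((b - s) ^ (α - 1) * Ge s)) =
        (g s * Ge s) * ((s - t) ^ (α - 1) * (b - s) ^ (α - 1)) by ring, norm_mul,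
        Real.norm_of_nonneg (show 0 ≤ (s - t) ^ (α - 1) * (b - s) ^ (α - 1) by positivity)]
      gcongr
      exact hD s ⟨has, hs'.le⟩
    rw [← norm_neg, ← hzero' t ht, intervalIntegral.integral_const_mul,
      integral_sub_rpow_mul_sub_rpow hα.1 hα.1 ht.2, norm_mul,
      Real.norm_of_nonneg (Real.rpow_nonneg hbt.le _),
      show α + α - 1 = α + (α - 1) by ring, Real.rpow_add hbt] at hbound
    have hpos : 0 < (b - t) ^ (α - 1) := Real.rpow_pos_of_pos hbt _
    refine le_of_mul_le_mul_left (hbound.trans_eq ?_) hpos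
    ring
  have hc : c = 0 := by
    have hcont : Continuous fun t : ℝ => D * ProbabilityTheory.beta α α * (b - t) ^ α := by
      have := hα.1.le
      exact continuous_const.mul ((continuous_const.sub continuous_id).rpow_const fun _ => Or.inr this)
    have hlim := (hcont.tendsto b).mono_left (nhdsWithin_le_nhds (s := Iio b))
    simp only [sub_self, Real.zero_rpow hα.1.ne', mul_zero] at hlim
    have : |c| ≤ 0 := by
      refine ge_of_tendsto hlim ?_
      filter_upwards [Ico_mem_nhdsLT hab] with t ht using hle t ht
    exact abs_eq_zero.1 (le_antisymm this (abs_nonneg _))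
  refine ⟨hc, ?_⟩
  have hGc : ContinuousOn G (Ico a b) :=
    ((continuousOn_sub_rpow _ a b).mul (hGe.mono Ico_subset_Icc_self)).congr hG
  have hgG : ∀ t ∈ Ioo a b, g t * G t = 0 := by
    refine eq_zero_of_fractional_integral_eq_zero hα (f := fun s => g s * G s)
      ((hg.mono Ico_subset_Icc_self).mul hGc) ?_ fun t ht => ?_
    · have h2 := (intervalIntegrable_sub_rpow hα.1 a b).mul_continuousOn (g := fun s => g s * Ge s)
        (by rw [uIcc_of_le hab.le]; exact hg.mul hGe)
      rw [intervalIntegrable_iff_integrableOn_Ioo_of_le hab.le] at h2 ⊢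
      refine h2.congr_fun (fun s hs => ?_) measurableSet_Ioo
      simp only [hG s ⟨hs.1.le, hs.2⟩]
      ring
    · have := hzero' t ht
      rw [hc, mul_zero] at this
      linarith
  refine Measure.eqOn_Ico_of_ae_eq (g := fun _ => 0) (μ := volume) ?_ hGc continuousOn_const
  rw [← Measure.restrict_congr_set (Ioo_ae_eq_Ico (a := a) (b := b))]
  filter_upwards [ae_restrict_of_ae_restrict_of_subset Ioo_subset_Icc_self hg0,
    ae_restrict_mem measurableSet_Ioo] with t h1 h2
  exact (mul_eq_zero.1 (hgG t h2)).resolve_left h1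

/-- If a scalar generalized Peano–Baker series vanishes identically, all its coefficients vanish. -/
theorem peanoBaker_coeff_eq_zero (hα : α ∈ Ioo (0:ℝ) 1) (hab : a < b)
    (hg : ContinuousOn g (Icc a b)) (hg0 : ∀ᵐ t ∂(volume.restrict (Icc a b)), g t ≠ 0)
    (h0 : ∀ t ∈ Ico a b, h 0 t = (b - t) ^ (α - 1) / Real.Gamma α)
    (hrec : ∀ k : ℕ, ∀ t ∈ Ico a b,
      h (k + 1) t = (1 / Real.Gamma α) * ∫ s in t..b, (s - t) ^ (α - 1) * g s * h k s)
    {c : ℕ → ℝ} {C ρ : ℝ} (hρ : 0 ≤ ρ) (hc : ∀ k, |c k| ≤ C * ρ ^ k)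
    {F Fe : ℕ → ℝ → ℝ} (hF : ∀ m, ∀ t ∈ Ico a b, HasSum (fun k => h k t * c (k + m)) (F m t))
    (hFe : ∀ m, ContinuousOn (Fe m) (Icc a b))
    (hFFe : ∀ m, ∀ t ∈ Ico a b, F m t = (b - t) ^ (α - 1) * Fe m t)
    (hF0 : ∀ t ∈ Ico a b, F 0 t = 0) (m : ℕ) : c m = 0 := by
  have step : ∀ m, (∀ t ∈ Ico a b, F m t = 0) → c m = 0 ∧ ∀ t ∈ Ico a b, F (m + 1) t = 0 := by
    intro m hm
    refine peanoBaker_series_eq_zero_step hα hab hg hg0 (hFe (m + 1)) (hFFe (m + 1)) fun t ht => ?_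
    have hcm : ∀ k, |c (k + m)| ≤ (C * ρ ^ m) * ρ ^ k := fun k =>
      (hc (k + m)).trans_eq (by ring)
    have := peanoBaker_series_eq (c := fun k => c (k + m)) (G := F (m + 1)) hα.1 hg h0 hrec hρ hcm
      (hF m) (fun t ht => by simpa only [add_assoc, add_comm 1 m] using hF (m + 1) t ht) t ht
    rw [hm t ht, h0 t ht, zero_add] at this
    exact this.symm
  have hall : ∀ m, ∀ t ∈ Ico a b, F m t = 0 := by
    intro m
    induction m with
    | zero => exact hF0
    | succ m ih => exact (step m ih).2
  exact (step m (hall m)).1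

end PeanoBaker

section WeightedIntegral

variable {E : Type*} [NormedAddCommGroup E] [NormedSpace ℝ E] {α a b : ℝ} {G H : ℝ → E}

theorem intervalIntegrable_of_eq_rpow_smul (hα : 0 < α) (hab : a < b)
    (hH : ContinuousOn H (Icc a b)) (hG : ∀ t ∈ Ico a b, G t = (b - t) ^ (α - 1) • H t) :
    IntervalIntegrable G volume a b := by
  have h2 := (intervalIntegrable_sub_rpow hα a b).smul_continuousOn
    (by rwa [uIcc_of_le hab.le] : ContinuousOn H (uIcc a b))
  rw [intervalIntegrable_iff_integrableOn_Ioo_of_le hab.le] at h2 ⊢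
  exact h2.congr_fun (fun t ht => (hG t ⟨ht.1.le, ht.2⟩).symm) measurableSet_Ioo

theorem intervalIntegrable_and_map_integral_of_eq_rpow_smul [FiniteDimensional ℝ E]
    (hα : 0 < α) (hab : a < b) (hH : ContinuousOn H (Icc a b))
    (hG : ∀ t ∈ Ico a b, G t = (b - t) ^ (α - 1) • H t) (l : E →ₗ[ℝ] ℝ) :
    IntervalIntegrable (fun t => l (G t)) volume a b ∧
      l (∫ t in a..b, G t) = ∫ t in a..b, l (G t) := by
  have := FiniteDimensional.complete ℝ E
  have hint := intervalIntegrable_of_eq_rpow_smul hα hab hH hG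
  have hlint : IntervalIntegrable (fun t => l (G t)) volume a b :=
    ⟨(LinearMap.toContinuousLinearMap l).integrable_comp hint.1,
      (LinearMap.toContinuousLinearMap l).integrable_comp hint.2⟩
  exact ⟨hlint,
    ((LinearMap.toContinuousLinearMap l).intervalIntegral_comp_comm hint).symm⟩

end WeightedIntegral

section Kalman

variable {d N : ℕ}

/-- The functional `M ↦ (v ᵥ* (M * P)) j` on matrices, as a continuous linear map. -/
noncomputable def vecMulEntryCLM (v : Fin d → ℝ) (P : Matrix (Fin d) (Fin N) ℝ) (j : Fin N) :
    Matrix (Fin d) (Fin d) ℝ →L[ℝ] ℝ :=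
  LinearMap.toContinuousLinearMap
    { toFun := fun M => (v ᵥ* (M * P)) j
      map_add' := fun M M' => by rw [Matrix.add_mul, vecMul_add, Pi.add_apply]
      map_smul' := fun r M => by
        rw [Matrix.smul_mul, vecMul_smul, Pi.smul_apply, RingHom.id_apply] }

theorem vecMulEntryCLM_apply (v : Fin d → ℝ) (P : Matrix (Fin d) (Fin N) ℝ) (j : Fin N)
    (M : Matrix (Fin d) (Fin d) ℝ) : vecMulEntryCLM v P j M = (v ᵥ* (M * P)) j := rfl

theorem exists_abs_vecMul_pow_mul_le (A : Matrix (Fin d) (Fin d) ℝ) (B : Matrix (Fin d) (Fin N) ℝ)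
    (v : Fin d → ℝ) (j : Fin N) :
    ∃ C ρ : ℝ, 0 ≤ ρ ∧ ∀ k : ℕ, |(v ᵥ* (A ^ k * B)) j| ≤ C * ρ ^ k := by
  let L : (Fin d → ℝ) →L[ℝ] (Fin d → ℝ) := LinearMap.toContinuousLinearMap A.vecMulLinear
  let l : (Fin d → ℝ) →L[ℝ] ℝ :=
    LinearMap.toContinuousLinearMap (LinearMap.proj j ∘ₗ B.vecMulLinear)
  have hpow : ∀ k : ℕ, ‖v ᵥ* A ^ k‖ ≤ ‖v‖ * ‖L‖ ^ k := by
    intro k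
    induction k with
    | zero => simp
    | succ k ih =>
      rw [pow_succ, ← vecMul_vecMul]
      calc ‖(v ᵥ* A ^ k) ᵥ* A‖ ≤ ‖L‖ * ‖v ᵥ* A ^ k‖ := L.le_opNorm _
        _ ≤ ‖L‖ * (‖v‖ * ‖L‖ ^ k) := by gcongr
        _ = _ := by ring
  refine ⟨‖l‖ * ‖v‖, ‖L‖, norm_nonneg _, fun k => ?_⟩
  rw [← vecMul_vecMul]
  calc |((v ᵥ* A ^ k) ᵥ* B) j| ≤ ‖l‖ * ‖v ᵥ* A ^ k‖ := l.le_opNorm _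
    _ ≤ ‖l‖ * (‖v‖ * ‖L‖ ^ k) := by gcongr; exact hpow k
    _ = _ := by ring

theorem vecMul_pow_mul_eq_zero_of_lt {A : Matrix (Fin d) (Fin d) ℝ} {B : Matrix (Fin d) (Fin N) ℝ}
    {v : Fin d → ℝ} {j : Fin N} (hv : ∀ k < d, (v ᵥ* (A ^ k * B)) j = 0) (k : ℕ) :
    (v ᵥ* (A ^ k * B)) j = 0 := by
  rw [← vecMulEntryCLM_apply, Matrix.pow_eq_aeval_mod_charpoly, Polynomial.aeval_eq_sum_range,
    map_sum]
  refine Finset.sum_eq_zero fun i _ => ?_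
  rw [map_smul, vecMulEntryCLM_apply]
  by_cases hi : (Polynomial.X ^ k %ₘ A.charpoly).coeff i = 0
  · rw [hi, zero_smul]
  · have h1 := Polynomial.le_degree_of_ne_zero hi
    have h2 := h1.trans_lt (Polynomial.degree_modByMonic_lt _ A.charpoly_monic)
    rw [Matrix.charpoly_degree_eq_dim, Fintype.card_fin] at h2
    rw [hv i (by exact_mod_cast h2), smul_zero]

theorem span_kalman_eq_top_iff (A : Matrix (Fin d) (Fin d) ℝ) (B : Matrix (Fin d) (Fin N) ℝ) :
    Submodule.span ℝ
        {x : Fin d → ℝ | ∃ k : ℕ, k < d ∧ ∃ j : Fin N, x = fun i => (A ^ k * B) i j} = ⊤ ↔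
      ∀ v : Fin d → ℝ, (∀ k j, (v ᵥ* (A ^ k * B)) j = 0) → v = 0 := by
  constructor
  · intro hspan v hv
    let f : (Fin d → ℝ) →ₗ[ℝ] ℝ := dotProductBilin ℝ ℝ v
    have hle : Submodule.span ℝ
        {x : Fin d → ℝ | ∃ k : ℕ, k < d ∧ ∃ j : Fin N, x = fun i => (A ^ k * B) i j} ≤
        LinearMap.ker f := by
      rw [Submodule.span_le]
      rintro x ⟨k, -, j, rfl⟩
      exact hv k j
    rw [hspan] at hle
    exact dotProduct_self_eq_zero.1 (hle (Submodule.mem_top (x := v)))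
  · intro hv
    by_contra hne
    obtain ⟨f, hf, hle⟩ := Submodule.exists_le_ker_of_lt_top _ (lt_top_iff_ne_top.2 hne)
    let v : Fin d → ℝ := fun i => f (Pi.single i 1)
    have hfv : ∀ x, f x = v ⬝ᵥ x := by
      intro x
      rw [LinearMap.pi_apply_eq_sum_univ f x]
      refine Finset.sum_congr rfl fun i _ => ?_
      rw [smul_eq_mul, mul_comm]
      congr 2
      ext j
      simp [Pi.single_apply, eq_comm]
    have hv0 : v = 0 := by
      refine hv v fun k j => vecMul_pow_mul_eq_zero_of_lt (fun k hk => ?_) k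
      have := hle (Submodule.subset_span ⟨k, hk, j, rfl⟩)
      rw [LinearMap.mem_ker, hfv] at this
      exact this
    exact hf (LinearMap.ext fun x => by rw [hfv, hv0, zero_dotProduct, LinearMap.zero_apply])

variable {α a b : ℝ} {Φ Φe : ℝ → Matrix (Fin d) (Fin d) ℝ}

theorem eq_rpow_smul_of_extension
    (hext : ∀ t ∈ Ico a b, Φe t = (b - t) ^ (1 - α) • Φ t) :
    ∀ t ∈ Ico a b, Φ t = (b - t) ^ (α - 1) • Φe t := by
  intro t ht
  have hbt : 0 < b - t := sub_pos.2 ht.2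
  rw [hext t ht, smul_smul, ← Real.rpow_add hbt]
  simp

theorem gramian_functional (hα : 0 < α) (hab : a < b) (B : Matrix (Fin d) (Fin N) ℝ)
    (hΦe : ContinuousOn Φe (Icc a b)) (hext : ∀ t ∈ Ico a b, Φe t = (b - t) ^ (1 - α) • Φ t)
    (l : Matrix (Fin d) (Fin d) ℝ →ₗ[ℝ] ℝ) :
    IntervalIntegrable (fun t => l ((b - t) ^ (1 - α) • (Φ t * B * Bᵀ * (Φ t)ᵀ))) volume a b ∧
      l (∫ t in a..b, (b - t) ^ (1 - α) • (Φ t * B * Bᵀ * (Φ t)ᵀ)) =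
        ∫ t in a..b, l ((b - t) ^ (1 - α) • (Φ t * B * Bᵀ * (Φ t)ᵀ)) := by
  have hc : ContinuousOn (fun t => Φe t * B * Bᵀ * (Φe t)ᵀ) (Icc a b) := by
    have hB : Continuous fun M : Matrix (Fin d) (Fin d) ℝ => M * B * Bᵀ * Mᵀ := by fun_prop
    exact hB.comp_continuousOn hΦe
  refine intervalIntegrable_and_map_integral_of_eq_rpow_smul hα hab hc (fun t ht => ?_) l
  have hbt : 0 < b - t := sub_pos.2 ht.2
  simp only [eq_rpow_smul_of_extension hext t ht, transpose_smul, Matrix.smul_mul,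
    Matrix.mul_smul, smul_smul]
  congr 1
  rw [← Real.rpow_add hbt, ← Real.rpow_add hbt]
  congr 1; ring

theorem vecMul_gramian_eq_zero_iff (hα : 0 < α) (hab : a < b) (B : Matrix (Fin d) (Fin N) ℝ)
    (hΦe : ContinuousOn Φe (Icc a b)) (hext : ∀ t ∈ Ico a b, Φe t = (b - t) ^ (1 - α) • Φ t)
    (v : Fin d → ℝ) :
    v ᵥ* (∫ t in a..b, (b - t) ^ (1 - α) • (Φ t * B * Bᵀ * (Φ t)ᵀ)) = 0 ↔
      ∀ t ∈ Ico a b, v ᵥ* (Φ t * B) = 0 := by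
  have hmul : ∀ t, v ᵥ* (Φ t * B * Bᵀ * (Φ t)ᵀ) = (v ᵥ* (Φ t * B)) ᵥ* (Φ t * B)ᵀ := by
    intro t
    rw [Matrix.mul_assoc, ← transpose_mul, vecMul_vecMul]
  constructor
  · intro hW
    let q : Matrix (Fin d) (Fin d) ℝ →ₗ[ℝ] ℝ :=
      { toFun := fun M => (v ᵥ* M) ⬝ᵥ v
        map_add' := fun M M' => by rw [vecMul_add, add_dotProduct]
        map_smul' := fun r M => by rw [vecMul_smul, smul_dotProduct, RingHom.id_apply] }
    have hq : ∀ t, q ((b - t) ^ (1 - α) • (Φ t * B * Bᵀ * (Φ t)ᵀ)) =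
        (b - t) ^ (1 - α) * ((v ᵥ* (Φ t * B)) ⬝ᵥ (v ᵥ* (Φ t * B))) := by
      intro t
      rw [map_smul, smul_eq_mul]
      congr 1
      change (v ᵥ* (Φ t * B * Bᵀ * (Φ t)ᵀ)) ⬝ᵥ v = _
      rw [hmul, vecMul_transpose, dotProduct_comm, dotProduct_mulVec]
    obtain ⟨hint, heq⟩ := gramian_functional hα hab B hΦe hext q
    have hq0 : q (∫ t in a..b, (b - t) ^ (1 - α) • (Φ t * B * Bᵀ * (Φ t)ᵀ)) = 0 := by
      change (v ᵥ* _) ⬝ᵥ v = 0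
      rw [hW, zero_dotProduct]
    simp only [hq] at hint heq
    rw [hq0, intervalIntegral.integral_of_le hab.le] at heq
    have hae := (integral_eq_zero_iff_of_nonneg_ae (by
      filter_upwards [ae_restrict_mem measurableSet_Ioc] with t ht
      exact mul_nonneg (Real.rpow_nonneg (sub_nonneg.2 ht.2) _)
        (Finset.sum_nonneg fun i _ => mul_self_nonneg _)) hint.1).1 heq.symm
    have hcont : ∀ j, ContinuousOn (fun t => (v ᵥ* (Φ t * B)) j) (Ico a b) := by
      intro j
      refine ContinuousOn.congr (f := fun t => (b - t) ^ (α - 1) * vecMulEntryCLM v B j (Φe t))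
        ((continuousOn_sub_rpow _ a b).mul ?_) fun t ht => ?_
      · exact (vecMulEntryCLM v B j).continuous.comp_continuousOn (hΦe.mono Ico_subset_Icc_self)
      · simp only
        rw [← smul_eq_mul, ← map_smul, ← eq_rpow_smul_of_extension hext t ht]
        rfl
    intro t ht
    ext j
    refine Measure.eqOn_Ico_of_ae_eq (g := fun _ => 0) (μ := volume) ?_ (hcont j)
      continuousOn_const ht
    rw [← Measure.restrict_congr_set (Ioo_ae_eq_Ico (a := a) (b := b))]
    filter_upwards [ae_restrict_of_ae_restrict_of_subset Ioo_subset_Ioc_self hae,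
      ae_restrict_mem measurableSet_Ioo] with s hs hsab
    have hpos : (b - s) ^ (1 - α) ≠ 0 := (Real.rpow_pos_of_pos (sub_pos.2 hsab.2) _).ne'
    have := dotProduct_self_eq_zero.1 ((mul_eq_zero.1 hs).resolve_left hpos)
    exact congrFun this j
  · intro hΦ
    ext i
    let l : Matrix (Fin d) (Fin d) ℝ →ₗ[ℝ] ℝ :=
      { toFun := fun M => (v ᵥ* M) i
        map_add' := fun M M' => by rw [vecMul_add, Pi.add_apply]
        map_smul' := fun r M => by rw [vecMul_smul, Pi.smul_apply, RingHom.id_apply] }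
    refine (gramian_functional hα hab B hΦe hext l).2.trans ?_
    refine intervalIntegral.integral_zero_ae ?_
    filter_upwards [Measure.ae_ne volume b] with t htb ht
    rw [uIoc_of_le hab.le] at ht
    rw [map_smul]
    have : l (Φ t * B * Bᵀ * (Φ t)ᵀ) = 0 := by
      change (v ᵥ* (Φ t * B * Bᵀ * (Φ t)ᵀ)) i = 0
      rw [hmul, hΦ t ⟨ht.1.le, lt_of_le_of_ne ht.2 htb⟩, zero_vecMul, Pi.zero_apply]
    rw [this, smul_zero]

end Kalman


/-- For the state-transition matrix `Φ(t) = Σ_k A^k h_k(t)` given by the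
generalized Peano–Baker series, the controllability Gramian
`W = ∫_a^b (b-t)^{1-α} Φ(t) B Bᵀ Φ(t)ᵀ dt` is invertible iff `(A,B)` satisfies the
Kalman rank condition. -/
theorem gramian_invertible_iff_kalman
    (d N : ℕ) (α a b : ℝ) (hα : α ∈ Set.Ioo (0:ℝ) 1) (hab : a < b)
    (A : Matrix (Fin d) (Fin d) ℝ) (hA : A.IsSymm)
    (B : Matrix (Fin d) (Fin N) ℝ)
    (g : ℝ → ℝ) (hg : ContinuousOn g (Set.Icc a b))
    (hg0 : ∀ᵐ t ∂(volume.restrict (Set.Icc a b)), g t ≠ 0)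
    (h : ℕ → ℝ → ℝ)
    (h0 : ∀ t ∈ Set.Ico a b, h 0 t = (b - t) ^ (α - 1) / Real.Gamma α)
    (hrec : ∀ k : ℕ, ∀ t ∈ Set.Ico a b,
      h (k + 1) t = (1 / Real.Gamma α) * ∫ s in t..b, (s - t) ^ (α - 1) * g s * h k s)
    (Φ : ℝ → Matrix (Fin d) (Fin d) ℝ)
    (hconv : ∀ t ∈ Set.Ico a b,
      Summable (fun k : ℕ => ‖h k t • A ^ k‖) ∧ HasSum (fun k : ℕ => h k t • A ^ k) (Φ t))
    (Φe : ℝ → Matrix (Fin d) (Fin d) ℝ) (hΦe : ContinuousOn Φe (Set.Icc a b))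
    (hext : ∀ t ∈ Set.Ico a b, Φe t = (b - t) ^ (1 - α) • Φ t) :
    IsUnit (∫ t in a..b, (b - t) ^ (1 - α) • (Φ t * B * Bᵀ * (Φ t)ᵀ)) ↔
      Submodule.span ℝ
        {x : Fin d → ℝ | ∃ k : ℕ, k < d ∧ ∃ j : Fin N, x = fun i => (A ^ k * B) i j} = ⊤ := by
  rw [Matrix.isUnit_iff_isUnit_det, isUnit_iff_ne_zero, span_kalman_eq_top_iff, Ne,
    ← exists_vecMul_eq_zero_iff]
  have key : ∀ v : Fin d → ℝ,
      v ᵥ* (∫ t in a..b, (b - t) ^ (1 - α) • (Φ t * B * Bᵀ * (Φ t)ᵀ)) = 0 ↔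
        ∀ k j, (v ᵥ* (A ^ k * B)) j = 0 := by
    intro v
    rw [vecMul_gramian_eq_zero_iff hα.1 hab B hΦe hext]
    have hsum : ∀ m j, ∀ t ∈ Ico a b, HasSum (fun k => h k t * (v ᵥ* (A ^ (k + m) * B)) j)
        (vecMulEntryCLM v (A ^ m * B) j (Φ t)) := by
      intro m j t ht
      have := (vecMulEntryCLM v (A ^ m * B) j).hasSum (hconv t ht).2
      refine this.congr_fun fun k => ?_
      rw [map_smul, vecMulEntryCLM_apply, pow_add, Matrix.mul_assoc, smul_eq_mul]
    constructor
    · intro hv k j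
      obtain ⟨C, ρ, hρ, hc⟩ := exists_abs_vecMul_pow_mul_le A B v j
      refine peanoBaker_coeff_eq_zero hα hab hg hg0 h0 hrec hρ hc
        (F := fun m t => vecMulEntryCLM v (A ^ m * B) j (Φ t))
        (Fe := fun m t => vecMulEntryCLM v (A ^ m * B) j (Φe t)) (fun m => hsum m j)
        (fun m => (vecMulEntryCLM v (A ^ m * B) j).continuous.comp_continuousOn hΦe) ?_ ?_ k
      · intro m t ht
        simp only [eq_rpow_smul_of_extension hext t ht, map_smul, smul_eq_mul]
      · intro t ht
        rw [vecMulEntryCLM_apply, pow_zero, Matrix.one_mul, hv t ht, Pi.zero_apply]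
    · intro hv t ht
      ext j
      have h1 := hsum 0 j t ht
      simp only [hv, mul_zero, pow_zero, Matrix.one_mul] at h1
      exact h1.unique hasSum_zero
  simp only [key]
  push Not
  exact ⟨fun H v hv => by_contra fun hne => by
      obtain ⟨k, j, hkj⟩ := H v hne; exact hkj (hv k j),
    fun H v hne => by_contra fun hcon => hne (H v fun k j => by
      push Not at hcon; exact hcon k j)⟩
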